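/- Let V_n, V ∈ H₊^{−m} with V_n → V in H₊^{−m}. Then S₊(V_n) → S₊(V) in the uniform resolvent sense: for λ in the common resolvent set, ‖R(λ, S₊(V_n)) − R(λ, S₊(V))‖ → 0 as n → ∞. -/

import Mathlib

/- STATEMENT 15: V_n → V in H₊^{−m} implies uniform resolvent
convergence S₊(V_n) → S₊(V): for λ in the common resolvent set,
‖R(λ,S₊(V_n)) − R(λ,S₊(V))‖ → 0.  Model: L²(0,1) ≅ ℓ²(ℤ); the
operators are encoded by their graphs and the resolvents are bounded
operators on ℓ². -/

noncomputable section
open Complex Filter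

abbrev E := lp (fun _ : ℤ => ℂ) 2

def wtp (s : ℝ) (k : ℤ) : ℝ := ((1 + |(2 * k : ℤ)| : ℝ)) ^ (2 * s)

def conv (a b : ℤ → ℂ) (k : ℤ) : ℂ := ∑' j : ℤ, a (k - j) * b j

def cplus (m : ℕ) (k : ℤ) : ℝ := (2 * Real.pi * (k : ℝ)) ^ (2 * m)

def graphS (m : ℕ) (V : ℤ → ℂ) : Set (E × E) :=
  {p | (Summable fun k : ℤ => wtp (m : ℝ) k * ‖p.1 k‖ ^ 2) ∧
       ∀ k : ℤ, p.2 k = ((cplus m k : ℝ) : ℂ) * p.1 k +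
          conv V (fun j => p.1 j) k}

def ResolventAt (G : Set (E × E)) (lam : ℂ) (R : E →L[ℂ] E) : Prop :=
  (∀ w : E, (R w, w + lam • R w) ∈ G) ∧
    ∀ p ∈ G, R (p.2 - lam • p.1) = p.1

/-- The `H₊^{-m}` norm of a coefficient sequence. -/
def hmnorm (m : ℕ) (a : ℤ → ℂ) : ℝ :=
  (∑' k : ℤ, wtp (-(m : ℝ)) k * ‖a k‖ ^ 2) ^ ((1 : ℝ) / 2)

open scoped ENNReal

def N2 (f : ℤ → ℝ≥0∞) : ℝ≥0∞ := (∑' k, f k ^ 2) ^ ((1:ℝ)/2)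

def MM (m : ℕ) (k : ℤ) : ℝ≥0∞ := ((1 + 2 * k.natAbs : ℕ) : ℝ≥0∞) ^ m

def TT (V p q : ℤ → ℝ≥0∞) : ℝ≥0∞ := ∑' k, ∑' j, V (k - j) * p j * q k

lemma N2_sq (f : ℤ → ℝ≥0∞) : N2 f ^ 2 = ∑' k, f k ^ 2 := by
  unfold N2
  rw [← ENNReal.rpow_natCast, ← ENNReal.rpow_mul]
  norm_num

lemma N2_le {f : ℤ → ℝ≥0∞} {c : ℝ≥0∞} (h : ∑' k, f k ^ 2 ≤ c ^ 2) : N2 f ≤ c := by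
  rw [← N2_sq] at h
  exact (ENNReal.pow_le_pow_left_iff two_ne_zero).1 h

lemma N2_mono {f g : ℤ → ℝ≥0∞} (h : ∀ k, f k ≤ g k) : N2 f ≤ N2 g := by
  apply N2_le
  rw [N2_sq]
  exact ENNReal.tsum_le_tsum fun k => by gcongr; exact h k

lemma N2_ne_top {f : ℤ → ℝ≥0∞} (h : ∑' k, f k ^ 2 ≠ ⊤) : N2 f ≠ ⊤ := by
  intro h'
  rw [← N2_sq, h'] at h
  simp at h

lemma N2_equiv (e : ℤ ≃ ℤ) (f : ℤ → ℝ≥0∞) : N2 (fun k => f (e k)) = N2 f := by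
  unfold N2
  rw [e.tsum_eq (fun k => f k ^ 2)]

lemma cs (f g : ℤ → ℝ≥0∞) : ∑' k, f k * g k ≤ N2 f * N2 g := by
  have h := ENNReal.lintegral_mul_le_Lp_mul_Lq (MeasureTheory.Measure.count : MeasureTheory.Measure ℤ)
    (p := 2) (q := 2) (by constructor <;> norm_num) (f := f) (g := g)
    (measurable_of_countable f).aemeasurable (measurable_of_countable g).aemeasurable
  simp only [MeasureTheory.lintegral_count, Pi.mul_apply] at h
  unfold N2
  convert h using 4 <;> norm_cast

lemma MM_pos (m : ℕ) (k : ℤ) : MM m k ≠ 0 := by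
  unfold MM; positivity

lemma MM_top (m : ℕ) (k : ℤ) : MM m k ≠ ⊤ := by
  unfold MM; finiteness

lemma MM_neg (m : ℕ) (k : ℤ) : MM m (-k) = MM m k := by
  unfold MM; simp

lemma MM_sub (m : ℕ) (k j : ℤ) : MM m (k - j) ≤ 2 ^ m * (MM m j + MM m k) := by
  unfold MM
  norm_cast
  rcases le_total j.natAbs k.natAbs with h | h
  · calc _ ≤ (2 * (1 + 2 * k.natAbs)) ^ m := by gcongr; omega
      _ = 2 ^ m * (1 + 2 * k.natAbs) ^ m := by rw [mul_pow]
      _ ≤ _ := by gcongr; omega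
  · calc _ ≤ (2 * (1 + 2 * j.natAbs)) ^ m := by gcongr; omega
      _ = 2 ^ m * (1 + 2 * j.natAbs) ^ m := by rw [mul_pow]
      _ ≤ _ := by gcongr; omega

lemma one_le_MM (m : ℕ) (k : ℤ) : 1 ≤ MM m k := by
  unfold MM; norm_cast; exact Nat.one_le_pow _ _ (by omega)

lemma MMinv (m : ℕ) (hm : 1 ≤ m) : N2 (fun k => (MM m k)⁻¹) ≠ ⊤ := by
  apply N2_ne_top
  have h1 : ∑' k : ℤ, ENNReal.ofReal (1 / (k:ℝ) ^ 2) ≠ ⊤ :=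
    (Real.summable_one_div_int_pow.2 (by norm_num)).tsum_ofReal_ne_top
  have h2 : ∑' k : ℤ, (if k = 0 then (1:ℝ≥0∞) else 0) ≠ ⊤ := by simp
  refine ne_top_of_le_ne_top (ENNReal.add_ne_top.2 ⟨h2, h1⟩) ?_
  rw [← ENNReal.tsum_add]
  refine ENNReal.tsum_le_tsum fun k => ?_
  by_cases hk : k = 0
  · subst hk
    simp [MM]
  · simp only [hk, if_false, zero_add]
    have hk' : 0 < k.natAbs := Int.natAbs_pos.2 hk
    have e : (k:ℝ)^2 = ((k.natAbs ^ 2 : ℕ) : ℝ) := by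
      push_cast
      rw [Nat.cast_natAbs]; push_cast; rw [sq_abs]
    rw [one_div, ENNReal.ofReal_inv_of_pos (by positivity), e, ENNReal.ofReal_natCast, ← ENNReal.inv_pow]
    apply ENNReal.inv_le_inv.2
    unfold MM
    norm_cast
    gcongr
    calc k.natAbs ≤ 1 + 2 * k.natAbs := by omega
      _ ≤ _ := Nat.le_self_pow (by omega) _

def CC (m : ℕ) : ℝ≥0∞ := 2 ^ m * (2 * N2 (fun k => (MM m k)⁻¹))

lemma CC_top (m : ℕ) (hm : 1 ≤ m) : CC m ≠ ⊤ := by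
  have := MMinv m hm
  unfold CC; finiteness

lemma l1 (m : ℕ) (q : ℤ → ℝ≥0∞) :
    ∑' k, q k ≤ N2 (fun k => (MM m k)⁻¹) * N2 (fun k => MM m k * q k) := by
  refine le_trans (le_of_eq ?_) (cs _ _)
  congr 1; ext k
  rw [← mul_assoc, ENNReal.inv_mul_cancel (MM_pos m k) (MM_top m k), one_mul]

lemma aux (m : ℕ) (a b q : ℤ → ℝ≥0∞) : ∑' k, ∑' j, a (k - j) * b j * q k ≤
    N2 (fun k => (MM m k)⁻¹) * (N2 a * N2 b * N2 (fun k => MM m k * q k)) := by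
  calc _ = ∑' k, (∑' j, a (k - j) * b j) * q k := by simp_rw [ENNReal.tsum_mul_right]
    _ ≤ ∑' k, (N2 a * N2 b) * q k := by
      refine ENNReal.tsum_le_tsum fun k => ?_
      gcongr
      refine (cs _ _).trans ?_
      exact le_of_eq (congrArg (· * _) (N2_equiv (Equiv.subLeft k) a))
    _ = N2 a * N2 b * ∑' k, q k := ENNReal.tsum_mul_left
    _ ≤ _ := by
      rw [mul_left_comm]
      gcongr
      exact l1 m q

lemma aux' (m : ℕ) (a b q : ℤ → ℝ≥0∞) : ∑' k, ∑' j, a (k - j) * q j * b k ≤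
    N2 (fun k => (MM m k)⁻¹) * (N2 a * N2 b * N2 (fun k => MM m k * q k)) := by
  rw [ENNReal.tsum_comm]
  calc _ = ∑' j, (∑' k, a (k - j) * b k) * q j := by
        simp_rw [← ENNReal.tsum_mul_right]
        congr! 4 with j k
        ring
    _ ≤ ∑' k, (N2 a * N2 b) * q k := by
      refine ENNReal.tsum_le_tsum fun k => ?_
      gcongr
      refine (cs _ _).trans ?_
      exact le_of_eq (congrArg (· * _) (N2_equiv (Equiv.subRight k) a))
    _ = N2 a * N2 b * ∑' k, q k := ENNReal.tsum_mul_left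
    _ ≤ _ := by
      rw [mul_left_comm]
      gcongr
      exact l1 m q

lemma tri (m : ℕ) (V p q : ℤ → ℝ≥0∞) : TT V p q ≤
    CC m * N2 (fun k => (MM m k)⁻¹ * V k) * N2 (fun k => MM m k * p k)
      * N2 (fun k => MM m k * q k) := by
  set a := fun k => (MM m k)⁻¹ * V k with ha
  have hV : ∀ l, V l = MM m l * a l := fun l => by
    rw [ha, ← mul_assoc, ENNReal.mul_inv_cancel (MM_pos m l) (MM_top m l), one_mul]
  calc TT V p q ≤ ∑' k, ∑' j, (2 ^ m * (a (k - j) * (MM m j * p j) * q k) +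
        2 ^ m * (a (k - j) * p j * (MM m k * q k))) := by
        unfold TT
        refine ENNReal.tsum_le_tsum fun k => ENNReal.tsum_le_tsum fun j => ?_
        rw [hV]
        calc _ ≤ 2 ^ m * (MM m j + MM m k) * a (k - j) * p j * q k := by
              gcongr; exact MM_sub m k j
          _ = _ := by ring
    _ = 2 ^ m * (∑' k, ∑' j, (a (k - j) * (MM m j * p j) * q k)) +
        2 ^ m * (∑' k, ∑' j, a (k - j) * p j * (MM m k * q k)) := by
        simp_rw [ENNReal.tsum_add, ENNReal.tsum_mul_left]
    _ ≤ 2 ^ m * (N2 (fun k => (MM m k)⁻¹) * (N2 a * N2 (fun k => MM m k * p k) * N2 (fun k => MM m k * q k))) +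
        2 ^ m * (N2 (fun k => (MM m k)⁻¹) * (N2 a * N2 (fun k => MM m k * q k) * N2 (fun k => MM m k * p k))) := by
        gcongr
        · exact aux m _ _ _
        · exact aux' m a (fun k => MM m k * q k) p
    _ = _ := by unfold CC; ring

lemma TT_l1 (V p q : ℤ → ℝ≥0∞) : TT V p q ≤ (∑' l, V l) * (N2 p * N2 q) := by
  calc TT V p q = ∑' k, ∑' l, V l * (p (k - l) * q k) := by
        unfold TT
        congr! 2 with k
        rw [← (Equiv.subLeft k).tsum_eq]
        simp [mul_assoc]
    _ = ∑' l, V l * ∑' k, p (k - l) * q k := by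
        rw [ENNReal.tsum_comm]; simp_rw [ENNReal.tsum_mul_left]
    _ ≤ ∑' l, V l * (N2 p * N2 q) := by
        refine ENNReal.tsum_le_tsum fun l => ?_
        gcongr
        refine (cs _ _).trans ?_
        exact le_of_eq (congrArg (· * _) (N2_equiv (Equiv.subRight l) p))
    _ = _ := ENNReal.tsum_mul_right

lemma TT_mono {V V' p q : ℤ → ℝ≥0∞} (h : ∀ k, V k ≤ V' k) : TT V p q ≤ TT V' p q :=
  ENNReal.tsum_le_tsum fun k => ENNReal.tsum_le_tsum fun j => by gcongr; exact h _

lemma TT_add (V V' p q : ℤ → ℝ≥0∞) : TT (fun k => V k + V' k) p q = TT V p q + TT V' p q := by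
  unfold TT
  simp_rw [add_mul, ENNReal.tsum_add]

lemma split (m : ℕ) (V : ℤ → ℝ≥0∞) (hVt : ∀ k, V k ≠ ⊤) (hV : N2 (fun k => (MM m k)⁻¹ * V k) ≠ ⊤)
    (δ : ℝ≥0∞) (hδ : δ ≠ 0) : ∃ A B : ℤ → ℝ≥0∞, (∀ k, V k = A k + B k) ∧
      N2 (fun k => (MM m k)⁻¹ * A k) ≤ δ ∧ ∑' k, B k ≠ ⊤ := by
  have h0 : ∑' k, ((MM m k)⁻¹ * V k) ^ 2 ≠ ⊤ := by
    rw [← N2_sq]; finiteness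
  have h1 := ENNReal.tendsto_tsum_compl_atTop_zero h0
  have h2 : ∀ᶠ s : Finset ℤ in atTop, _ < δ ^ 2 :=
    h1.eventually (gt_mem_nhds (pos_iff_ne_zero.2 (pow_ne_zero 2 hδ)))
  obtain ⟨s, hs⟩ := h2.exists
  classical
  refine ⟨fun k => if k ∈ s then 0 else V k, fun k => if k ∈ s then V k else 0, ?_, ?_, ?_⟩
  · intro k; by_cases h : k ∈ s <;> simp [h]
  · apply N2_le
    refine le_trans (le_of_eq ?_) hs.le
    rw [← tsum_subtype_eq_of_support_subset (s := {k | k ∉ s})]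
    · apply tsum_congr
      rintro ⟨k, hk⟩
      simp at hk
      simp [hk]
    · intro k hk
      simp at hk
      exact hk.1
  · rw [tsum_eq_sum (s := s)]
    · exact ENNReal.sum_ne_top.2 fun k _ => by split_ifs <;> simp [hVt]
    · intro k hk; simp [hk]

lemma absorb {X Y : ℝ≥0∞} (hX : X ≠ ⊤) (h : X ≤ Y + 2⁻¹ * X) : X ≤ 2 * Y := by
  by_cases hY : Y = ⊤
  · simp [hY]
  lift X to NNReal using hX
  lift Y to NNReal using hY
  have e : (2⁻¹ : ℝ≥0∞) = ((2⁻¹ : NNReal) : ℝ≥0∞) := by simp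
  rw [e] at h
  norm_cast at h ⊢
  rw [← NNReal.coe_le_coe] at h ⊢
  push_cast at h ⊢
  linarith

lemma E_summable (x : E) : Summable fun k => ‖x k‖ ^ 2 := by
  have := (lp.memℓp x).summable (by norm_num)
  simpa using this

lemma enorm_E (x : E) : ‖x‖ₑ = N2 (fun k => ‖x k‖ₑ) := by
  have h : ‖x‖ ^ 2 = ∑' k, ‖x k‖ ^ 2 := by
    have := lp.norm_rpow_eq_tsum (p := 2) (by norm_num) x
    simpa using this
  have h2 : ‖x‖ₑ ^ 2 = N2 (fun k => ‖x k‖ₑ) ^ 2 := by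
    rw [N2_sq]
    simp_rw [← ofReal_norm, ← ENNReal.ofReal_pow (norm_nonneg _)]
    rw [h, ENNReal.ofReal_tsum_of_nonneg (fun k => by positivity) (E_summable x)]
  exact le_antisymm ((ENNReal.pow_le_pow_left_iff two_ne_zero).1 h2.le)
    ((ENNReal.pow_le_pow_left_iff two_ne_zero).1 h2.ge)

lemma wtp_pos' (m : ℕ) (k : ℤ) (z : ℂ) :
    ENNReal.ofReal (wtp (m : ℝ) k * ‖z‖ ^ 2) = (MM m k * ‖z‖ₑ) ^ 2 := by
  have e : wtp (m : ℝ) k = (((1 + 2 * k.natAbs : ℕ) ^ m) ^ 2 : ℕ) := by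
    unfold wtp
    have : (1 + ((|2 * k| : ℤ) : ℝ)) = ((1 + 2 * k.natAbs : ℕ) : ℝ) := by
      push_cast; rw [Nat.cast_natAbs, abs_mul]; simp
    rw [this, ← pow_mul, mul_comm m 2]
    push_cast
    rw [← Real.rpow_natCast]
    push_cast
    rfl
  rw [e, ENNReal.ofReal_mul (by positivity), ENNReal.ofReal_natCast, ENNReal.ofReal_pow (norm_nonneg _), ofReal_norm, mul_pow, MM]
  push_cast
  rfl

lemma wtp_neg (m : ℕ) (k : ℤ) : wtp (-(m : ℝ)) k = (wtp (m : ℝ) k)⁻¹ := by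
  unfold wtp
  rw [← Real.rpow_neg (by positivity)]
  congr 1; ring

lemma wtp_gt (s : ℝ) (k : ℤ) : 0 < wtp s k := by
  unfold wtp; positivity

lemma wtp_neg' (m : ℕ) (k : ℤ) (z : ℂ) :
    ENNReal.ofReal (wtp (-(m : ℝ)) k * ‖z‖ ^ 2) = ((MM m k)⁻¹ * ‖z‖ₑ) ^ 2 := by
  have := wtp_pos' m k 1
  simp at this
  rw [wtp_neg, ENNReal.ofReal_mul (by have := wtp_gt m k; positivity), ENNReal.ofReal_inv_of_pos (wtp_gt _ _), this,
    ENNReal.ofReal_pow (norm_nonneg _), ofReal_norm, mul_pow, ENNReal.inv_pow]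

lemma hm_top {m : ℕ} {a : ℤ → ℂ} (h : Summable fun k : ℤ => wtp (-(m : ℝ)) k * ‖a k‖ ^ 2) :
    N2 (fun k => (MM m k)⁻¹ * ‖a k‖ₑ) ≠ ⊤ := by
  apply N2_ne_top
  simp_rw [← wtp_neg']
  exact h.tsum_ofReal_ne_top

lemma Hm_top {m : ℕ} {a : ℤ → ℂ} (h : Summable fun k : ℤ => wtp (m : ℝ) k * ‖a k‖ ^ 2) :
    N2 (fun k => MM m k * ‖a k‖ₑ) ≠ ⊤ := by
  apply N2_ne_top
  simp_rw [← wtp_pos']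
  exact h.tsum_ofReal_ne_top

lemma hm_eq {m : ℕ} {a : ℤ → ℂ} (h : Summable fun k : ℤ => wtp (-(m : ℝ)) k * ‖a k‖ ^ 2) :
    N2 (fun k => (MM m k)⁻¹ * ‖a k‖ₑ) = ENNReal.ofReal (hmnorm m a) := by
  have h0 : ∀ k, 0 ≤ wtp (-(m : ℝ)) k * ‖a k‖ ^ 2 := fun k => by
    have := wtp_gt (-(m:ℝ)) k; positivity
  unfold N2 hmnorm
  rw [← ENNReal.ofReal_rpow_of_nonneg (tsum_nonneg h0) (by norm_num), ENNReal.ofReal_tsum_of_nonneg h0 h]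
  simp_rw [← wtp_neg']

lemma hm_sub {m : ℕ} {a b : ℤ → ℂ} (ha : Summable fun k : ℤ => wtp (-(m : ℝ)) k * ‖a k‖ ^ 2)
    (hb : Summable fun k : ℤ => wtp (-(m : ℝ)) k * ‖b k‖ ^ 2) :
    Summable fun k : ℤ => wtp (-(m : ℝ)) k * ‖a k - b k‖ ^ 2 := by
  refine Summable.of_nonneg_of_le (fun k => ?_) (fun k => ?_) ((ha.add hb).mul_left 2)
  · have := wtp_gt (-(m:ℝ)) k; positivity
  · have := wtp_gt (-(m:ℝ)) k
    have h1 : ‖a k - b k‖ ^ 2 ≤ 2 * (‖a k‖ ^ 2 + ‖b k‖ ^ 2) := by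
      have h2 := norm_sub_le (a k) (b k)
      nlinarith [sq_nonneg (‖a k‖ - ‖b k‖), norm_nonneg (a k - b k)]
    nlinarith

lemma MM_cplus (m : ℕ) (hm : 1 ≤ m) (k : ℤ) : MM m k ^ 2 ≤ 1 + ‖((cplus m k : ℝ) : ℂ)‖ₑ := by
  by_cases hk : k = 0
  · subst hk; simp [MM]
  · have hk' : 0 < k.natAbs := Int.natAbs_pos.2 hk
    refine le_trans ?_ le_add_self
    have e : ‖((cplus m k : ℝ) : ℂ)‖ₑ = ENNReal.ofReal (cplus m k) := by
      rw [← ofReal_norm, Complex.norm_real, Real.norm_of_nonneg]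
      unfold cplus; exact (even_two_mul m).pow_nonneg _
    have e2 : MM m k ^ 2 = ENNReal.ofReal ((1 + 2 * (k.natAbs:ℝ)) ^ (2 * m)) := by
      unfold MM
      rw [← pow_mul, ENNReal.ofReal_pow (by positivity), mul_comm 2 m]
      congr 1
      rw [← ENNReal.ofReal_natCast]; push_cast; rfl
    rw [e, e2]
    apply ENNReal.ofReal_le_ofReal
    unfold cplus
    rw [← (even_two_mul m).pow_abs (2 * Real.pi * (k:ℝ))]
    have e3 : |2 * Real.pi * (k:ℝ)| = 2 * Real.pi * (k.natAbs : ℝ) := by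
      rw [abs_mul, abs_of_pos Real.two_pi_pos, Nat.cast_natAbs]; push_cast; rfl
    rw [e3]
    gcongr
    have : (1:ℝ) ≤ k.natAbs := by exact_mod_cast hk'
    nlinarith [Real.pi_gt_three]

lemma enorm_tsum_le' (f : ℤ → ℂ) : ‖∑' k, f k‖ₑ ≤ ∑' k, ‖f k‖ₑ := by
  by_cases h : ∑' k, ‖f k‖ₑ = ⊤
  · simp [h]
  · have hs : Summable fun k => ‖f k‖₊ := ENNReal.tsum_coe_ne_top_iff_summable.1 h
    have := nnnorm_tsum_le hs
    calc ‖∑' k, f k‖ₑ ≤ ((∑' k, ‖f k‖₊ : NNReal) : ℝ≥0∞) := by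
          rw [enorm_eq_nnnorm]; exact_mod_cast this
      _ = _ := ENNReal.coe_tsum hs

lemma energy (m : ℕ) (hm : 1 ≤ m) (W : ℤ → ℂ) (u g : E) (h : (u, g) ∈ graphS m W) :
    N2 (fun k => MM m k * ‖u k‖ₑ) ^ 2 ≤ ‖u‖ₑ ^ 2 + ‖g‖ₑ * ‖u‖ₑ +
      TT (fun k => ‖W k‖ₑ) (fun k => ‖u k‖ₑ) (fun k => ‖u k‖ₑ) := by
  obtain ⟨-, h2⟩ := h
  simp only at h2
  rw [N2_sq, enorm_E, enorm_E, N2_sq]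
  refine le_trans ?_ (add_le_add_left (add_le_add_right (cs _ _) _) _)
  unfold TT
  rw [← ENNReal.tsum_add, ← ENNReal.tsum_add]
  refine ENNReal.tsum_le_tsum fun k => ?_
  have h3 : ‖((cplus m k : ℝ) : ℂ)‖ₑ * ‖u k‖ₑ ≤ ‖g k‖ₑ + ∑' j, ‖W (k - j)‖ₑ * ‖u j‖ₑ := by
    rw [← enorm_mul]
    have : ((cplus m k : ℝ) : ℂ) * u k = g k - conv W (fun j => u j) k := by
      rw [h2 k]; ring
    rw [this]
    refine enorm_sub_le.trans ?_
    gcongr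
    unfold conv
    refine (enorm_tsum_le' _).trans (le_of_eq ?_)
    simp_rw [enorm_mul]
  rw [ENNReal.tsum_mul_right, mul_pow]
  calc MM m k ^ 2 * ‖u k‖ₑ ^ 2 ≤ (1 + ‖((cplus m k : ℝ) : ℂ)‖ₑ) * ‖u k‖ₑ ^ 2 := by
        gcongr; exact MM_cplus m hm k
    _ = ‖u k‖ₑ ^ 2 + (‖((cplus m k : ℝ) : ℂ)‖ₑ * ‖u k‖ₑ) * ‖u k‖ₑ := by ring
    _ ≤ ‖u k‖ₑ ^ 2 + (‖g k‖ₑ + ∑' j, ‖W (k - j)‖ₑ * ‖u j‖ₑ) * ‖u k‖ₑ := by gcongr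
    _ = _ := by ring

lemma garding (m : ℕ) (hm : 1 ≤ m) (V : ℤ → ℂ) (lam : ℂ)
    (hV : N2 (fun k => (MM m k)⁻¹ * ‖V k‖ₑ) ≠ ⊤) :
    ∃ δ K : ℝ≥0∞, δ ≠ 0 ∧ K ≠ ⊤ ∧ ∀ (W : ℤ → ℂ) (R : E →L[ℂ] E),
      N2 (fun k => (MM m k)⁻¹ * ‖W k - V k‖ₑ) ≤ δ → ResolventAt (graphS m W) lam R →
      ∀ w : E, N2 (fun k => MM m k * ‖(R w) k‖ₑ) ≤ K * (1 + ‖R‖ₑ) * ‖w‖ₑ := by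
  have hC := CC_top m hm
  set δ : ℝ≥0∞ := (4 * (CC m + 1))⁻¹ with hδ
  have hδ0 : δ ≠ 0 := by rw [hδ]; apply ENNReal.inv_ne_zero.2; finiteness
  have hCδ : CC m * δ + CC m * δ ≤ 2⁻¹ := by
    have : (CC m + 1) * δ = 4⁻¹ := by
      rw [hδ, ENNReal.mul_inv (by simp) (by simp), mul_left_comm, ENNReal.mul_inv_cancel (by simp) (by finiteness), mul_one]
    calc _ ≤ (CC m + 1) * δ + (CC m + 1) * δ := by gcongr <;> exact le_self_add
      _ = 4⁻¹ + 4⁻¹ := by rw [this]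
      _ = 2⁻¹ := by
        rw [← two_mul, show (4:ℝ≥0∞) = 2 * 2 by norm_num, ENNReal.mul_inv (by simp) (by simp), ← mul_assoc,
          ENNReal.mul_inv_cancel (by simp) (by simp), one_mul]
  obtain ⟨A, B, hAB, hA, hB⟩ := split m (fun k => ‖V k‖ₑ) (fun k => by simp) hV δ hδ0
  set S := ∑' k, B k
  refine ⟨δ, 2 * (1 + ‖lam‖ₑ + S + 1), hδ0, by finiteness, fun W R hW hR w => ?_⟩
  set u := R w with hu
  have hg := hR.1 w
  rw [← hu] at hg
  have hfin := Hm_top hg.1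
  have he := energy m hm W u _ hg
  simp only at hfin
  set X := N2 (fun k => MM m k * ‖u k‖ₑ) with hX
  have hT : TT (fun k => ‖W k‖ₑ) (fun k => ‖u k‖ₑ) (fun k => ‖u k‖ₑ) ≤
      2⁻¹ * X ^ 2 + S * ‖u‖ₑ ^ 2 := by
    calc _ ≤ TT (fun k => ‖W k - V k‖ₑ + (A k + B k)) (fun k => ‖u k‖ₑ) (fun k => ‖u k‖ₑ) := by
          apply TT_mono
          intro k
          rw [← hAB]
          calc ‖W k‖ₑ = ‖(W k - V k) + V k‖ₑ := by simp
            _ ≤ _ := enorm_add_le _ _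
      _ ≤ CC m * δ * X * X + (CC m * δ * X * X + S * (‖u‖ₑ * ‖u‖ₑ)) := by
          rw [TT_add (fun k => ‖W k - V k‖ₑ) (fun k => A k + B k), TT_add A B]
          gcongr
          · refine (tri m _ _ _).trans ?_
            gcongr
          · refine (tri m _ _ _).trans ?_
            gcongr
          · refine (TT_l1 _ _ _).trans ?_
            rw [enorm_E]
      _ = (CC m * δ + CC m * δ) * X ^ 2 + S * ‖u‖ₑ ^ 2 := by ring
      _ ≤ _ := by gcongr
  have hgn : ‖w + lam • u‖ₑ ≤ ‖w‖ₑ + ‖lam‖ₑ * ‖u‖ₑ := by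
    refine (enorm_add_le _ _).trans ?_
    rw [enorm_smul]
  have hXX : X ^ 2 ≤ ((1 + ‖lam‖ₑ + S) * ‖u‖ₑ ^ 2 + ‖w‖ₑ * ‖u‖ₑ) + 2⁻¹ * X ^ 2 := by
    calc X ^ 2 ≤ _ := he
      _ ≤ ‖u‖ₑ ^ 2 + (‖w‖ₑ + ‖lam‖ₑ * ‖u‖ₑ) * ‖u‖ₑ + (2⁻¹ * X ^ 2 + S * ‖u‖ₑ ^ 2) := by gcongr
      _ = _ := by ring
  have hX2 := absorb (by finiteness) hXX
  have hun : ‖u‖ₑ ≤ (1 + ‖R‖ₑ) * ‖w‖ₑ := by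
    calc ‖u‖ₑ ≤ ‖R‖ₑ * ‖w‖ₑ := R.le_opENorm w
      _ ≤ _ := by gcongr; exact le_add_self
  apply (ENNReal.pow_le_pow_left_iff two_ne_zero).1
  have h1 : ‖w‖ₑ ≤ (1 + ‖R‖ₑ) * ‖w‖ₑ := by
    calc ‖w‖ₑ = 1 * ‖w‖ₑ := by simp
      _ ≤ _ := by gcongr; exact le_self_add
  set D := 1 + ‖lam‖ₑ + S
  calc X ^ 2 ≤ _ := hX2
    _ ≤ 2 * (D * ((1 + ‖R‖ₑ) * ‖w‖ₑ) ^ 2 + ((1 + ‖R‖ₑ) * ‖w‖ₑ) * ((1 + ‖R‖ₑ) * ‖w‖ₑ)) := by gcongr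
    _ = (2 * (D + 1)) * ((1 + ‖R‖ₑ) * ‖w‖ₑ) ^ 2 := by ring
    _ ≤ (2 * (D + 1)) ^ 2 * ((1 + ‖R‖ₑ) * ‖w‖ₑ) ^ 2 := by
      gcongr
      apply le_self_pow₀ _ two_ne_zero
      calc (1:ℝ≥0∞) ≤ 1 + D := le_self_add
        _ = 1 * (D + 1) := by ring
        _ ≤ _ := by gcongr; norm_num
    _ = _ := by ring

def FF (W u v : ℤ → ℂ) (p : ℤ × ℤ) : ℂ := W (p.1 - p.2) * u p.2 * v (-p.1)

lemma FF_bound (m : ℕ) (W u v : ℤ → ℂ) : ∑' p, ‖FF W u v p‖ₑ ≤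
    CC m * N2 (fun k => (MM m k)⁻¹ * ‖W k‖ₑ) * N2 (fun k => MM m k * ‖u k‖ₑ)
      * N2 (fun k => MM m k * ‖v k‖ₑ) := by
  have h := tri m (fun k => ‖W k‖ₑ) (fun k => ‖u k‖ₑ) (fun k => ‖v (-k)‖ₑ)
  have e : N2 (fun k => MM m k * ‖v (-k)‖ₑ) = N2 (fun k => MM m k * ‖v k‖ₑ) := by
    rw [← N2_equiv (Equiv.neg ℤ) (fun k => MM m k * ‖v k‖ₑ)]
    simp [MM_neg]
  rw [e] at h
  refine le_trans (le_of_eq ?_) h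
  rw [ENNReal.tsum_prod']
  simp [TT, FF, enorm_mul]

lemma FF_summable {m : ℕ} (hm : 1 ≤ m) {W u v : ℤ → ℂ}
    (hW : N2 (fun k => (MM m k)⁻¹ * ‖W k‖ₑ) ≠ ⊤)
    (hu : N2 (fun k => MM m k * ‖u k‖ₑ) ≠ ⊤)
    (hv : N2 (fun k => MM m k * ‖v k‖ₑ) ≠ ⊤) : Summable (FF W u v) := by
  have hC := CC_top m hm
  have h : ∑' p, ‖FF W u v p‖ₑ ≠ ⊤ :=
    ne_top_of_le_ne_top (by finiteness) (FF_bound m W u v)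
  have hs : Summable fun k => ‖FF W u v k‖₊ := ENNReal.tsum_coe_ne_top_iff_summable.1 h
  exact Summable.of_nnnorm hs

lemma FF_left {W u v : ℤ → ℂ} (h : Summable (FF W u v)) :
    HasSum (fun k => conv W u k * v (-k)) (∑' p, FF W u v p) := by
  refine h.hasSum.prod_fiberwise fun k => ?_
  have h1 := (h.prod_factor k).hasSum
  convert! h1 using 1
  unfold conv FF
  rw [← tsum_mul_right]

lemma FF_right {W u v : ℤ → ℂ} (h : Summable (FF W u v)) :
    HasSum (fun k => u k * conv W v (-k)) (∑' p, FF W u v p) := by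
  have hs : HasSum (fun p : ℤ × ℤ => FF W u v p.swap) (∑' p, FF W u v p) :=
    (Equiv.prodComm ℤ ℤ).hasSum_iff.2 h.hasSum
  refine hs.prod_fiberwise fun k => ?_
  have h1 := (hs.summable.prod_factor k).hasSum
  convert! h1 using 1
  unfold conv FF
  rw [← tsum_mul_left, ← (Equiv.neg ℤ).tsum_eq]
  apply tsum_congr
  intro j
  simp only [Equiv.neg_apply, Prod.fst_swap, Prod.snd_swap]
  rw [show -k - -j = j - k by ring]
  ring

lemma pair {m : ℕ} (hm : 1 ≤ m) {W1 W2 : ℤ → ℂ} {lam : ℂ} {u w v g : E}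
    (hW1 : N2 (fun k => (MM m k)⁻¹ * ‖W1 k‖ₑ) ≠ ⊤)
    (hW2 : N2 (fun k => (MM m k)⁻¹ * ‖W2 k‖ₑ) ≠ ⊤)
    (hu : (u, w + lam • u) ∈ graphS m W1) (hv : (v, g + lam • v) ∈ graphS m W2) :
    HasSum (fun k => u k * g (-k) - w k * v (-k))
      (∑' p, FF W2 u v p - ∑' p, FF W1 u v p) := by
  have hu' := Hm_top hu.1
  have hv' := Hm_top hv.1
  have h := (FF_right (FF_summable hm hW2 hu' hv')).sub (FF_left (FF_summable hm hW1 hu' hv'))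
  convert! h using 1
  ext k
  have h1 := hu.2 k
  have h2 := hv.2 (-k)
  have e : cplus m (-k) = cplus m k := by
    unfold cplus
    rw [← (even_two_mul m).neg_pow]; push_cast; ring_nf
  rw [e] at h2
  simp only [lp.coeFn_add, lp.coeFn_smul, Pi.add_apply, Pi.smul_apply, smul_eq_mul] at h1 h2
  linear_combination u k * h2 - v (-k) * h1

lemma diff_bound {m : ℕ} (hm : 1 ≤ m) {V W : ℤ → ℂ} {lam : ℂ} {R Q : E →L[ℂ] E}
    (hV : N2 (fun k => (MM m k)⁻¹ * ‖V k‖ₑ) ≠ ⊤)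
    (hW : N2 (fun k => (MM m k)⁻¹ * ‖W k‖ₑ) ≠ ⊤)
    (hR : ResolventAt (graphS m V) lam R) (hQ : ResolventAt (graphS m W) lam Q)
    {a b : ℝ≥0∞} 
    (hRb : ∀ w : E, N2 (fun k => MM m k * ‖(R w) k‖ₑ) ≤ a * ‖w‖ₑ)
    (hQb : ∀ w : E, N2 (fun k => MM m k * ‖(Q w) k‖ₑ) ≤ b * ‖w‖ₑ) (w : E) :
    ‖Q w - R w‖ₑ ≤ CC m * N2 (fun k => (MM m k)⁻¹ * ‖W k - V k‖ₑ) * b * a * ‖w‖ₑ := by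
  set x := Q w - R w with hx
  have hmem : Memℓp (fun k : ℤ => star (x (-k))) 2 := by
    apply memℓp_gen
    have := (Equiv.neg ℤ).summable_iff.2 (E_summable x)
    simpa [Function.comp_def] using this
  let g : E := ⟨fun k : ℤ => star (x (-k)), hmem⟩
  have hgk : ∀ k, g k = star (x (-k)) := fun k => rfl
  have hgn : ‖g‖ₑ = ‖x‖ₑ := by
    rw [enorm_E, enorm_E, ← N2_equiv (Equiv.neg ℤ) (fun k => ‖x k‖ₑ)]
    congr 1; ext k
    rw [hgk]
    simp only [Equiv.neg_apply, ← ofReal_norm, norm_star]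
  have p1 := pair hm hW hV (hQ.1 w) (hR.1 g)
  have p2 := pair hm hV hV (hR.1 w) (hR.1 g)
  have p3 := p1.sub p2
  have sV := FF_summable hm hV (Hm_top (hQ.1 w).1) (Hm_top (hR.1 g).1)
  have sW := FF_summable hm hW (Hm_top (hQ.1 w).1) (Hm_top (hR.1 g).1)
  have hval : ((‖x‖ ^ 2 : ℝ) : ℂ) = ∑' p, FF (fun k => V k - W k) (Q w) (R g) p := by
    have h : ‖x‖ ^ 2 = ∑' k, ‖x k‖ ^ 2 := by
      have := lp.norm_rpow_eq_tsum (p := 2) (by norm_num) x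
      simpa using this
    have h2 : HasSum (fun k => ((‖x k‖ ^ 2 : ℝ) : ℂ)) ((‖x‖ ^ 2 : ℝ) : ℂ) := by
      rw [h]
      exact Complex.hasSum_ofReal.2 (E_summable x).hasSum
    have h3 : ∑' p, FF (fun k => V k - W k) (Q w) (R g) p =
        ∑' p, FF V (Q w) (R g) p - ∑' p, FF W (Q w) (R g) p := by
      rw [← sV.tsum_sub sW]
      apply tsum_congr
      intro p
      unfold FF
      ring
    rw [h3]
    refine h2.unique ?_
    convert! p3 using 1
    · ext k
      rw [hgk, neg_neg]
      have : x k = Q w k - R w k := rfl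
      have e := Complex.mul_conj' (x k)
      rw [← starRingEnd_apply]
      push_cast
      rw [← e]
      nth_rewrite 1 [this]
      ring
    · simp
  have hb : ‖x‖ₑ ^ 2 ≤ (CC m * N2 (fun k => (MM m k)⁻¹ * ‖W k - V k‖ₑ) * b * a * ‖w‖ₑ) * ‖x‖ₑ := by
    have e1 : ‖x‖ₑ ^ 2 = ‖((‖x‖ ^ 2 : ℝ) : ℂ)‖ₑ := by
      rw [← ofReal_norm, ← ofReal_norm, Complex.norm_real, ← ENNReal.ofReal_pow (norm_nonneg _)]
      simp
    rw [e1, hval]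
    refine enorm_tsum_le_tsum_enorm.trans ((FF_bound m _ _ _).trans ?_)
    calc _ ≤ CC m * N2 (fun k => (MM m k)⁻¹ * ‖V k - W k‖ₑ) * (b * ‖w‖ₑ) * (a * ‖g‖ₑ) := by
          gcongr
          · exact hQb w
          · exact hRb g
      _ = _ := by
          rw [hgn]
          simp_rw [enorm_sub_rev (V _) (W _)]
          ring
  by_cases h0 : ‖x‖ₑ = 0
  · rw [h0]; exact zero_le
  · rw [sq] at hb
    exact (ENNReal.mul_le_mul_iff_left h0 enorm_ne_top).1 hb

theorem uniform_resolvent_convergence (m : ℕ) (hm : 1 ≤ m)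
    (V : ℤ → ℂ) (Vn : ℕ → ℤ → ℂ)
    (hV : Summable fun k : ℤ => wtp (-(m : ℝ)) k * ‖V k‖ ^ 2)
    (hVn : ∀ n, Summable fun k : ℤ => wtp (-(m : ℝ)) k * ‖Vn n k‖ ^ 2)
    (hconv : Tendsto (fun n => hmnorm m (fun k => Vn n k - V k)) atTop (nhds 0)) :
    ∀ lam : ℂ, ∀ R : E →L[ℂ] E, ∀ Rn : ℕ → E →L[ℂ] E,
      ResolventAt (graphS m V) lam R →
      (∀ n, ResolventAt (graphS m (Vn n)) lam (Rn n)) →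
      Tendsto (fun n => ‖Rn n - R‖) atTop (nhds 0) := by
  intro lam R Rn hR hRn
  have hV' := hm_top hV
  obtain ⟨δ, K, hδ, hK, hG⟩ := garding m hm V lam hV'
  have hC := CC_top m hm
  set ε : ℕ → ℝ := fun n => hmnorm m (fun k => Vn n k - V k) with hε
  have hε0 : ∀ n, 0 ≤ ε n := fun n => by
    rw [hε]; unfold hmnorm
    apply Real.rpow_nonneg
    exact tsum_nonneg fun k => by have := wtp_gt (-(m:ℝ)) k; positivity
  have hεe : ∀ n, N2 (fun k => (MM m k)⁻¹ * ‖Vn n k - V k‖ₑ) = ENNReal.ofReal (ε n) :=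
    fun n => hm_eq (hm_sub (hVn n) hV)
  have hRb := hG V R (by
    have : N2 (fun k => (MM m k)⁻¹ * ‖V k - V k‖ₑ) ≤ 0 := N2_le (by simp)
    exact this.trans (zero_le)) hR
  set L : ℝ := (CC m).toReal * K.toReal * (K.toReal * (1 + ‖R‖)) with hL
  have hL0 : 0 ≤ L := by positivity
  have hev : ∀ᶠ n in atTop, ENNReal.ofReal (ε n) ≤ δ := by
    have : Tendsto (fun n => ENNReal.ofReal (ε n)) atTop (nhds 0) := by
      have := ENNReal.tendsto_ofReal hconv
      simpa using this
    exact (this.eventually (gt_mem_nhds (pos_iff_ne_zero.2 hδ))).mono fun n h => h.le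
  have hLε : Tendsto (fun n => L * ε n) atTop (nhds 0) := by
    simpa using hconv.const_mul L
  have hev2 : ∀ᶠ n in atTop, L * ε n < 1 / 2 := hLε.eventually (gt_mem_nhds (by norm_num))
  have hfin : ∀ᶠ n in atTop, ‖Rn n - R‖ ≤ 2 * (L * ε n) * (1 + ‖R‖) := by
    filter_upwards [hev, hev2] with n h1 h2
    have hQb := hG (Vn n) (Rn n) (by rw [hεe]; exact h1) (hRn n)
    have hd := diff_bound hm hV' (hm_top (hVn n)) hR (hRn n) hRb hQb
    have hop : ‖Rn n - R‖ ≤ L * ε n * (1 + ‖Rn n‖) := by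
      refine ContinuousLinearMap.opNorm_le_bound _ (by have := hε0 n; positivity) fun w => ?_
      have hw := ENNReal.toReal_mono (by rw [hεe]; finiteness) (hd w)
      rw [hεe] at hw
      simp only [ENNReal.toReal_mul, toReal_enorm, ENNReal.toReal_ofReal (hε0 n),
        ENNReal.toReal_add ENNReal.one_ne_top enorm_ne_top, ENNReal.toReal_one] at hw
      calc _ = ‖Rn n w - R w‖ := rfl
        _ ≤ _ := hw
        _ = _ := by rw [hL]; ring
    have ht : ‖Rn n‖ ≤ ‖R‖ + ‖Rn n - R‖ := by
      have := norm_add_le R (Rn n - R)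
      simpa using this
    have hp : 0 ≤ L * ε n := mul_nonneg hL0 (hε0 n)
    have h3 : L * ε n * (1 + ‖Rn n‖) ≤ L * ε n * (1 + (‖R‖ + ‖Rn n - R‖)) := by gcongr
    have h4 : L * ε n * ‖Rn n - R‖ ≤ 1 / 2 * ‖Rn n - R‖ := by gcongr
    nlinarith
  refine squeeze_zero' (Eventually.of_forall fun n => norm_nonneg _) hfin ?_
  simpa using (hLε.const_mul 2).mul_const (1 + ‖R‖)
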